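/- For every integer K ≥ 25 and γ = 1/K with s_c = ⌊√K⌋, the value (H_K - 1)/(H_{s_c} - s_c²/(K - s_c + 1)) is at most 4. -/

import Mathlib

open Finset

/-- The `n`-th harmonic number `H_n = ∑_{i=1}^n 1/i`. -/
noncomputable def H (n : ℕ) : ℝ := ∑ i ∈ Finset.range n, (1 : ℝ) / (i + 1)

lemma H_succ_aux (n : ℕ) : H (n+1) = H n + 1 / ((n:ℝ) + 1) := by
  simp [H, Finset.sum_range_succ]

lemma H_mono_aux : Monotone H := by
  refine monotone_nat_of_le_succ fun n => ?_
  rw [H_succ_aux]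
  have : (0:ℝ) ≤ 1 / ((n:ℝ) + 1) := by positivity
  linarith

lemma H_add_aux (n m : ℕ) : H (n+m) ≤ H n + m * (1 / ((n:ℝ) + 1)) := by
  induction m with
  | zero => simp
  | succ k ih =>
    rw [← add_assoc, H_succ_aux]
    have : 1 / (((n + k : ℕ):ℝ) + 1) ≤ 1 / ((n:ℝ) + 1) := by
      apply one_div_le_one_div_of_le (by positivity)
      push_cast
      have : (0:ℝ) ≤ k := by positivity
      linarith
    push_cast at *
    linarith

lemma H_main_aux (s : ℕ) (hs : 5 ≤ s) : H (s^2 + 2*s) + 79/21 ≤ 4 * H s := by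
  induction s, hs using Nat.le_induction with
  | base => norm_num [H, Finset.sum_range_succ]
  | succ s hs ih =>
    have h := H_add_aux (s^2+2*s) (2*s+3)
    have e : s^2+2*s + (2*s+3) = (s+1)^2 + 2*(s+1) := by ring
    rw [e] at h
    rw [H_succ_aux s]
    have h2 : ((2*s+3 : ℕ):ℝ) * (1 / (((s^2+2*s : ℕ):ℝ) + 1)) ≤ 4 * (1 / ((s:ℝ)+1)) := by
      push_cast
      have : (s:ℝ)^2 + 2*s + 1 = (s+1)^2 := by ring
      rw [this, mul_one_div, mul_one_div, div_le_div_iff₀ (by positivity) (by positivity)]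
      have : (0:ℝ) ≤ s := by positivity
      nlinarith [pow_nonneg this 2]
    linarith

/-- For every integer `K ≥ 25`, with `s_c = ⌊√K⌋`, the denominator
`H_{s_c} - s_c²/(K - s_c + 1)` is positive and
`(H_K - 1)/(H_{s_c} - s_c²/(K - s_c + 1)) ≤ 4`. -/
theorem gap_at_endpoint (K : ℕ) (hK : 25 ≤ K) :
    let s_c : ℕ := Nat.floor (Real.sqrt K)
    0 < H s_c - (s_c : ℝ) ^ 2 / ((K : ℝ) - s_c + 1) ∧
      (H K - 1) / (H s_c - (s_c : ℝ) ^ 2 / ((K : ℝ) - s_c + 1)) ≤ 4 := by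
  intro s
  have hsE : s = Nat.sqrt K := Real.nat_floor_real_sqrt_eq_nat_sqrt
  clear_value s
  have h1 : s * s ≤ K := hsE ▸ Nat.sqrt_le K
  have h2 : K ≤ s * s + s + s := hsE ▸ Nat.sqrt_le_add K
  have h5 : 5 ≤ s := by nlinarith
  have hm := H_main_aux s h5
  have hKm : H K ≤ H (s^2+2*s) := H_mono_aux (by nlinarith)
  have hH5 : H 5 ≤ H s := H_mono_aux h5
  have h5v : (2:ℝ) ≤ H 5 := by norm_num [H, Finset.sum_range_succ]
  have h1r : (s:ℝ) * s ≤ K := by exact_mod_cast h1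
  have h5r : (5:ℝ) ≤ s := by exact_mod_cast h5
  have hq : (s : ℝ) ^ 2 / ((K : ℝ) - s + 1) ≤ 25/21 := by
    rw [div_le_iff₀ (by nlinarith)]
    nlinarith
  have hpos : 0 < H s - (s : ℝ) ^ 2 / ((K : ℝ) - s + 1) := by linarith
  refine ⟨hpos, ?_⟩
  rw [div_le_iff₀ hpos]
  linarith
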